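/- arXiv:2210.05002 — 2 statements merged into one kernel-verified Lean document; each statement's English description precedes it below -/
import Mathlib

section
/- Let p be a prime and f > 1. Let s and s' be digit tuples, neither having all entries equal to p−1, with s'_{f−1} ≥ 1, satisfying Σ_{j=0}^{f−1} p^{f−1−j} s_j ≡ (s'_{f−1} − 2) + Σ_{j=0}^{f−2} p^{f−1−j} s'_j (mod p^f − 1). Then (s, s') is given by exactly one of the following (unspecified entries satisfy s'_j = s_j): (1) s_{f−1} ≤ p−3 and s'_{f−1} = s_{f−1} + 2; (2) for some i ∈ [1, f−1]: s_{f−1} = … = s_{f−i} = p−1, s_{f−1−i} ∈ [0,p−2]; s'_{f−1} = 1, s'_{f−2} = … = s'_{f−i} = 0, s'_{f−1−i} = s_{f−1−i} + 1; (3) s_{f−1} = p−2 and s_j = p−1 for all j ≤ f−2; s'_{f−1} = 1 and s'_j = 0 for all j ≤ f−2. Conversely, every pair of one of these forms satisfies the congruence and the hypotheses. -/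
namespace Stmt15

/-- weighted digit sum `Σⱼ sⱼ p^{f-1-j}` -/
def wsum (p f : ℕ) (s : Fin f → ℕ) : ℤ :=
  ∑ j : Fin f, (s j : ℤ) * (p : ℤ) ^ (f - 1 - (j : ℕ))

/-- weighted sum with the coefficient at index `i` replaced by the integer `v` -/
def wsumMod (p f : ℕ) (s : Fin f → ℕ) (i : ℕ) (v : ℤ) : ℤ :=
  ∑ j : Fin f, (if (j : ℕ) = i then v else (s j : ℤ)) * (p : ℤ) ^ (f - 1 - (j : ℕ))

def ExactlyOne3 (a b c : Prop) : Prop :=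
  (a ∨ b ∨ c) ∧ ¬(a ∧ b) ∧ ¬(a ∧ c) ∧ ¬(b ∧ c)

/-- family (1): `s_{f-1} ≤ p-3`, `s'_{f-1} = s_{f-1}+2`, all other entries equal. -/
def fam1 (p f : ℕ) (hf : 1 < f) (s s' : Fin f → ℕ) : Prop :=
  s ⟨f - 1, by omega⟩ ≤ p - 3 ∧
  s' ⟨f - 1, by omega⟩ = s ⟨f - 1, by omega⟩ + 2 ∧
  (∀ j : Fin f, (j : ℕ) + 2 ≤ f → s' j = s j)

/-- family (2): `s = (p-1, …, p-1, ≤ p-2, *)`, `s' = (1, 0, …, 0, s_{f-1-i}+1, *)`. -/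
def fam2 (p f : ℕ) (hf : 1 < f) (s s' : Fin f → ℕ) : Prop :=
  ∃ (i : ℕ) (_ : 1 ≤ i) (_ : i + 1 ≤ f),
    (∀ j : Fin f, f ≤ (j : ℕ) + i → s j = p - 1) ∧
    s ⟨f - 1 - i, by omega⟩ ≤ p - 2 ∧
    s' ⟨f - 1, by omega⟩ = 1 ∧
    (∀ j : Fin f, f ≤ (j : ℕ) + i → (j : ℕ) + 2 ≤ f → s' j = 0) ∧
    s' ⟨f - 1 - i, by omega⟩ = s ⟨f - 1 - i, by omega⟩ + 1 ∧
    (∀ j : Fin f, (j : ℕ) + i + 2 ≤ f → s' j = s j)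

/-- family (3): `s = (p-2, p-1, …, p-1)`, `s' = (1, 0, …, 0)`. -/
def fam3 (p f : ℕ) (hf : 1 < f) (s s' : Fin f → ℕ) : Prop :=
  s ⟨f - 1, by omega⟩ = p - 2 ∧
  (∀ j : Fin f, (j : ℕ) + 2 ≤ f → s j = p - 1) ∧
  s' ⟨f - 1, by omega⟩ = 1 ∧
  (∀ j : Fin f, (j : ℕ) + 2 ≤ f → s' j = 0)

end Stmt15

namespace Stmt15

/-- Value in base `p` of the first `n` digits of `a`, least significant digit first. -/
def digitValue (p n : ℕ) (a : ℕ → ℕ) : ℕ :=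
  ∑ k ∈ Finset.range n, a k * p ^ k

lemma digitValue_zero (p : ℕ) (a : ℕ → ℕ) : digitValue p 0 a = 0 := rfl

lemma digitValue_succ (p n : ℕ) (a : ℕ → ℕ) :
    digitValue p (n + 1) a = a 0 + p * digitValue p n (fun k => a (k + 1)) := by
  unfold digitValue
  rw [Finset.sum_range_succ', Finset.mul_sum, pow_zero, mul_one, add_comm]
  congr 1
  exact Finset.sum_congr rfl fun k _ => by ring

lemma digitValue_congr {p n : ℕ} {a b : ℕ → ℕ} (h : ∀ k < n, a k = b k) :
    digitValue p n a = digitValue p n b :=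
  Finset.sum_congr rfl fun k hk => by rw [h k (Finset.mem_range.1 hk)]

/-- Euclidean uniqueness: a digit and a multiple of `p` are determined by their sum. -/
lemma eq_and_eq_of_add_mul_eq {p x y A B : ℕ} (hx : x < p) (hy : y < p)
    (h : x + p * A = y + p * B) : x = y ∧ A = B := by
  have hxy : x = y := by
    have := congrArg (· % p) h
    simpa [Nat.add_mul_mod_self_left, Nat.mod_eq_of_lt hx, Nat.mod_eq_of_lt hy] using this
  subst hxy
  exact ⟨rfl, Nat.eq_of_mul_eq_mul_left (by omega) (Nat.add_left_cancel h)⟩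

lemma digitValue_lt {p : ℕ} (n : ℕ) {a : ℕ → ℕ} (ha : ∀ k < n, a k < p) :
    digitValue p n a < p ^ n := by
  induction n generalizing a with
  | zero => simp [digitValue_zero]
  | succ n ih =>
    have h := ih (a := fun k => a (k + 1)) fun k hk => ha _ (by omega)
    have h0 := ha 0 (by omega)
    rw [digitValue_succ, pow_succ']
    nlinarith [Nat.mul_le_mul_left p (Nat.succ_le_of_lt h)]

lemma eq_of_digitValue_eq {p : ℕ} (n : ℕ) {a b : ℕ → ℕ} (ha : ∀ k < n, a k < p)
    (hb : ∀ k < n, b k < p) (h : digitValue p n a = digitValue p n b) :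
    ∀ k < n, a k = b k := by
  induction n generalizing a b with
  | zero => intro k hk; omega
  | succ n ih =>
    rw [digitValue_succ, digitValue_succ] at h
    obtain ⟨h0, h1⟩ := eq_and_eq_of_add_mul_eq (ha 0 (by omega)) (hb 0 (by omega)) h
    have := ih (fun k hk => ha (k + 1) (by omega)) (fun k hk => hb (k + 1) (by omega)) h1
    rintro (_ | k) hk
    · exact h0
    · exact this k (by omega)

lemma digitValue_const_add_one {p : ℕ} (hp : 1 ≤ p) (n : ℕ) :
    digitValue p n (fun _ => p - 1) + 1 = p ^ n := by
  induction n with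
  | zero => simp [digitValue_zero]
  | succ n ih =>
    rw [digitValue_succ, pow_succ', ← ih]
    simp only [mul_add, mul_one]
    omega

/-- Adding one propagates a carry through a maximal run of digits `p - 1`. -/
lemma exists_carry_of_digitValue_eq_add_one {p : ℕ} (n : ℕ) {a b : ℕ → ℕ}
    (ha : ∀ k < n, a k < p) (hb : ∀ k < n, b k < p)
    (h : digitValue p n b = digitValue p n a + 1) :
    ∃ i < n, (∀ k < i, a k = p - 1 ∧ b k = 0) ∧ b i = a i + 1 ∧
      ∀ k < n, i < k → b k = a k := by
  induction n generalizing a b with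
  | zero => simp [digitValue_zero] at h
  | succ n ih =>
    rw [digitValue_succ, digitValue_succ] at h
    have ha0 := ha 0 (by omega)
    have hb0 := hb 0 (by omega)
    have ha' : ∀ k < n, a (k + 1) < p := fun k hk => ha _ (by omega)
    have hb' : ∀ k < n, b (k + 1) < p := fun k hk => hb _ (by omega)
    by_cases hc : a 0 + 1 < p
    · obtain ⟨h0, h1⟩ := eq_and_eq_of_add_mul_eq (A := digitValue p n fun k => b (k + 1))
        (B := digitValue p n fun k => a (k + 1)) hb0 hc (by omega)
      have := eq_of_digitValue_eq n hb' ha' h1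
      refine ⟨0, by omega, by simp, h0, ?_⟩
      rintro (_ | k) hk hk'
      · omega
      · exact this k (by omega)
    · obtain ⟨h0, h1⟩ := eq_and_eq_of_add_mul_eq (y := 0)
        (A := digitValue p n fun k => b (k + 1))
        (B := digitValue p n (fun k => a (k + 1)) + 1) hb0 (by omega)
        (by rw [mul_add, mul_one]; omega)
      obtain ⟨i, hi, hlow, hmid, hhigh⟩ := ih ha' hb' h1
      refine ⟨i + 1, by omega, ?_, hmid, ?_⟩
      · rintro (_ | k) hk
        · exact ⟨by omega, h0⟩
        · exact hlow k (by omega)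
      · rintro (_ | k) hk hk'
        · omega
        · exact hhigh k (by omega) (by omega)

lemma digitValue_eq_add_one_of_carry {p : ℕ} (hp : 1 ≤ p) (n : ℕ) {a b : ℕ → ℕ} {i : ℕ}
    (hi : i < n) (hlow : ∀ k < i, a k = p - 1 ∧ b k = 0) (hmid : b i = a i + 1)
    (hhigh : ∀ k < n, i < k → b k = a k) :
    digitValue p n b = digitValue p n a + 1 := by
  induction n generalizing a b i with
  | zero => omega
  | succ n ih =>
    rw [digitValue_succ, digitValue_succ]
    cases i with
    | zero =>
      rw [digitValue_congr (p := p) fun k (hk : k < n) =>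
        hhigh (k + 1) (by omega) (by omega)]
      omega
    | succ i =>
      rw [ih (a := fun k => a (k + 1)) (b := fun k => b (k + 1)) (i := i) (by omega)
        (fun k hk => hlow (k + 1) (by omega)) hmid
        (fun k hk hk' => hhigh (k + 1) (by omega) (by omega))]
      obtain ⟨h1, h2⟩ := hlow 0 (by omega)
      rw [mul_add, mul_one]
      omega

lemma wsum_eq_digitValue (p : ℕ) {f : ℕ} (hf : 0 < f) (s : Fin f → ℕ) :
    wsum p f s = digitValue p f (fun k => s ⟨f - 1 - k, by omega⟩) := by
  unfold wsum digitValue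
  push_cast
  rw [← Fin.sum_univ_eq_sum_range (fun k => (s ⟨f - 1 - k, by omega⟩ : ℤ) * (p : ℤ) ^ k) f,
    ← Equiv.sum_comp Fin.revPerm]
  refine Finset.sum_congr rfl fun j _ => ?_
  have hj := j.isLt
  congr 2
  · congr 2
    ext
    simp [Fin.val_rev]
    omega
  · simp [Fin.val_rev]
    omega

lemma wsumMod_last_sub (p : ℕ) {f : ℕ} (hf : 0 < f) (s : Fin f → ℕ) (c : ℤ) :
    wsumMod p f s (f - 1) ((s ⟨f - 1, by omega⟩ : ℤ) - c) = wsum p f s - c := by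
  unfold wsumMod wsum
  rw [eq_sub_iff_add_eq, ← eq_sub_iff_add_eq', ← Finset.sum_sub_distrib,
    Finset.sum_eq_single ⟨f - 1, by omega⟩]
  · simp
  · intro j _ hj
    rw [if_neg fun h => hj (Fin.ext h), sub_self]
  · simp

/-- Congruence to a value shifted by two: no wrap-around, or the unique one. -/
lemma eq_add_two_or_of_modEq {q S S' : ℕ} (hS : S + 1 < q) (hS' : S' + 1 < q) (hpos : 1 ≤ S')
    (h : (S : ℤ) ≡ S' - 2 [ZMOD (q : ℤ) - 1]) :
    S' = S + 2 ∨ S' = 1 ∧ S + 2 = q := by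
  obtain ⟨c, hc⟩ := h.dvd
  have hlt : c < 1 := by
    by_contra! hge
    nlinarith
  have hgt : -2 < c := by
    by_contra! hle
    nlinarith
  obtain rfl | rfl : c = 0 ∨ c = -1 := by omega
  · left; omega
  · right; omega

/-- Digit tuples, least significant digit first, whose values differ by two. -/
lemma digits_of_digitValue_eq_add_two {p n : ℕ} {a b : ℕ → ℕ}
    (ha : ∀ k < n + 1, a k < p) (hb : ∀ k < n + 1, b k < p) (hb0 : 1 ≤ b 0)
    (h : digitValue p (n + 1) b = digitValue p (n + 1) a + 2) :
    (b 0 = a 0 + 2 ∧ ∀ k < n, b (k + 1) = a (k + 1)) ∨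
    (a 0 = p - 1 ∧ b 0 = 1 ∧ digitValue p n (fun k => b (k + 1)) =
      digitValue p n (fun k => a (k + 1)) + 1) := by
  rw [digitValue_succ, digitValue_succ] at h
  have ha0 := ha 0 (by omega)
  have hb0' := hb 0 (by omega)
  by_cases hc : a 0 + 2 < p
  · obtain ⟨h0, h1⟩ := eq_and_eq_of_add_mul_eq (A := digitValue p n fun k => b (k + 1))
      (B := digitValue p n fun k => a (k + 1)) hb0' hc (by omega)
    exact Or.inl ⟨h0, eq_of_digitValue_eq n (fun k hk => hb _ (by omega))
      (fun k hk => ha _ (by omega)) h1⟩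
  · obtain ⟨h0, h1⟩ := eq_and_eq_of_add_mul_eq (y := a 0 + 2 - p)
      (A := digitValue p n fun k => b (k + 1))
      (B := digitValue p n (fun k => a (k + 1)) + 1) hb0' (by omega)
      (by rw [mul_add, mul_one]; omega)
    exact Or.inr ⟨by omega, by omega, h1⟩

/-- Digit tuples, least significant digit first, of values `p ^ (n + 1) - 2` and `1`. -/
lemma digits_of_digitValue_wrap {p n : ℕ} {a b : ℕ → ℕ} (hp : 2 ≤ p)
    (ha : ∀ k < n + 1, a k < p) (hb : ∀ k < n + 1, b k < p)
    (h : digitValue p (n + 1) b = 1) (h' : digitValue p (n + 1) a + 2 = p ^ (n + 1)) :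
    a 0 = p - 2 ∧ (∀ k < n, a (k + 1) = p - 1) ∧ b 0 = 1 ∧ ∀ k < n, b (k + 1) = 0 := by
  rw [digitValue_succ] at h h'
  have hzero : digitValue p n (fun _ => 0) = 0 := by simp [digitValue]
  obtain ⟨hb0, hb1⟩ := eq_and_eq_of_add_mul_eq (y := 1) (B := 0) (hb 0 (by omega)) (by omega) h
  have hconst := digitValue_const_add_one (p := p) (by omega) n
  rw [pow_succ', ← hconst, mul_add, mul_one] at h'
  obtain ⟨ha0, ha1⟩ := eq_and_eq_of_add_mul_eq (y := p - 2)
    (A := digitValue p n fun k => a (k + 1)) (B := digitValue p n fun _ => p - 1)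
    (ha 0 (by omega)) (by omega) (by omega)
  refine ⟨ha0, ?_, hb0, ?_⟩
  · exact eq_of_digitValue_eq n (fun k hk => ha _ (by omega)) (fun k hk => by omega) ha1
  · exact eq_of_digitValue_eq n (fun k hk => hb _ (by omega)) (fun k hk => by omega)
      (hb1.trans hzero.symm)

lemma digitValue_add_one_lt {p n : ℕ} (hp : 1 ≤ p) {a : ℕ → ℕ} (ha : ∀ k < n, a k < p)
    (hne : ¬ ∀ k < n, a k = p - 1) : digitValue p n a + 1 < p ^ n := by
  refine lt_of_le_of_ne (digitValue_lt n ha) fun h => hne ?_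
  rw [← digitValue_const_add_one hp n] at h
  exact eq_of_digitValue_eq n ha (fun k hk => by omega) (Nat.add_right_cancel h)

end Stmt15

open Stmt15 in
/-- Classification of pairs of digit tuples `(s, s')` with `s'_{f-1} ≥ 1` and
`Σ pʲ sⱼ ≡ (s'_{f-1}-2) + Σ_{j≤f-2} p^{f-1-j} s'_j (mod p^f - 1)`. -/
theorem statement15 (p f : ℕ) (hp : p.Prime) (hf : 1 < f)
    (s s' : Fin f → ℕ)
    (hs : ∀ j, s j ≤ p - 1) (hs' : ∀ j, s' j ≤ p - 1)
    (hnS : ¬ ∀ j, s j = p - 1) (hnS' : ¬ ∀ j, s' j = p - 1) :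
    (1 ≤ s' ⟨f - 1, by omega⟩ →
      Int.ModEq ((p : ℤ) ^ f - 1) (wsum p f s)
        (wsumMod p f s' (f - 1) ((s' ⟨f - 1, by omega⟩ : ℤ) - 2)) →
      ExactlyOne3 (fam1 p f hf s s') (fam2 p f hf s s') (fam3 p f hf s s')) ∧
    ((fam1 p f hf s s' ∨ fam2 p f hf s s' ∨ fam3 p f hf s s') →
      (Int.ModEq ((p : ℤ) ^ f - 1) (wsum p f s)
          (wsumMod p f s' (f - 1) ((s' ⟨f - 1, by omega⟩ : ℤ) - 2)) ∧
        1 ≤ s' ⟨f - 1, by omega⟩)) := by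
  have hp2 := hp.two_le
  obtain ⟨n, rfl⟩ : ∃ n, f = n + 1 := ⟨f - 1, by omega⟩
  rw [wsumMod_last_sub p (by omega), wsum_eq_digitValue p (by omega) s,
    wsum_eq_digitValue p (by omega) s']
  set a : ℕ → ℕ := fun k => s ⟨n + 1 - 1 - k, by omega⟩ with ha_def
  set b : ℕ → ℕ := fun k => s' ⟨n + 1 - 1 - k, by omega⟩ with hb_def
  have ha : ∀ k < n + 1, a k < p := fun k _ => by
    have := hs ⟨n + 1 - 1 - k, by omega⟩
    simp only [ha_def]; omega
  have hb : ∀ k < n + 1, b k < p := fun k _ => by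
    have := hs' ⟨n + 1 - 1 - k, by omega⟩
    simp only [hb_def]; omega
  have hsa : ∀ j : Fin (n + 1), s j = a (n - j) := fun j => by
    simp only [ha_def]; congr 1; ext; simp; omega
  have hsb : ∀ j : Fin (n + 1), s' j = b (n - j) := fun j => by
    simp only [hb_def]; congr 1; ext; simp; omega
  have ha_all : ¬ ∀ k < n + 1, a k = p - 1 := fun h =>
    hnS fun j => by rw [hsa]; exact h _ (by omega)
  have hb_all : ¬ ∀ k < n + 1, b k = p - 1 := fun h =>
    hnS' fun j => by rw [hsb]; exact h _ (by omega)
  simp only [ExactlyOne3, fam1, fam2, fam3, hsa, hsb]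
  simp only [Nat.add_sub_cancel, Nat.sub_self]
  clear_value a b
  clear ha_def hb_def hsa hsb hs hs' hnS hnS'
  clear s s'
  have hidx : ∀ i, i + 1 ≤ n + 1 → n - (n - i) = i := fun i hi => by omega
  refine ⟨fun hpos hmod => ⟨?_, ?_, ?_, ?_⟩, ?_⟩
  · have hSpos : 1 ≤ digitValue p (n + 1) b := by rw [digitValue_succ]; omega
    obtain h | ⟨h, h'⟩ := eq_add_two_or_of_modEq (q := p ^ (n + 1))
      (digitValue_add_one_lt (by omega) ha ha_all) (digitValue_add_one_lt (by omega) hb hb_all)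
      hSpos (by exact_mod_cast hmod)
    · obtain ⟨h0, h1⟩ | ⟨h0, h1, h2⟩ := digits_of_digitValue_eq_add_two ha hb hpos h
      · have := hb 0 (by omega)
        refine Or.inl ⟨by omega, h0, fun j hj => ?_⟩
        have := h1 (n - j - 1) (by omega)
        rwa [show n - (j : ℕ) - 1 + 1 = n - j by omega] at this
      · obtain ⟨i, hi, hlow, hmid, hhigh⟩ := exists_carry_of_digitValue_eq_add_one n
          (fun k hk => ha (k + 1) (by omega)) (fun k hk => hb (k + 1) (by omega)) h2
        have hbi := hb (i + 1) (by omega)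
        refine Or.inr (Or.inl ⟨i + 1, by omega, by omega, ?_, ?_, h1, ?_, ?_, ?_⟩)
        · intro j hj
          rcases hk : n - (j : ℕ) with _ | k
          · exact h0
          · exact (hlow k (by omega)).1
        · rw [hidx _ (by omega)]; omega
        · intro j hj hj'
          rcases hk : n - (j : ℕ) with _ | k
          · omega
          · exact (hlow k (by omega)).2
        · rw [hidx _ (by omega)]; exact hmid
        · intro j hj
          have := hhigh (n - j - 1) (by omega) (by omega)
          rwa [show n - (j : ℕ) - 1 + 1 = n - j by omega] at this
    · obtain ⟨h0, h1, h2, h3⟩ := digits_of_digitValue_wrap hp2 ha hb h h'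
      refine Or.inr (Or.inr ⟨h0, fun j hj => ?_, h2, fun j hj => ?_⟩)
      · have := h1 (n - j - 1) (by omega)
        rwa [show n - (j : ℕ) - 1 + 1 = n - j by omega] at this
      · have := h3 (n - j - 1) (by omega)
        rwa [show n - (j : ℕ) - 1 + 1 = n - j by omega] at this
  · rintro ⟨⟨h1, h2, -⟩, i, hi, -, -, -, h3, -⟩
    omega
  · rintro ⟨⟨h1, h2, -⟩, -, -, h3, -⟩
    omega
  · rintro ⟨⟨i, hi, hi', h1, -⟩, h3, -⟩
    have := h1 (Fin.last n) (by simp; omega)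
    simp only [Fin.val_last, Nat.sub_self] at this
    omega
  · have of_eq (h : digitValue p (n + 1) b = digitValue p (n + 1) a + 2) :
        (digitValue p (n + 1) a : ℤ) ≡ digitValue p (n + 1) b - 2
          [ZMOD (p : ℤ) ^ (n + 1) - 1] := by
      rw [h]; push_cast; rw [add_sub_cancel_right]
    rintro (⟨-, h0, h1⟩ | ⟨i, hi, hi', h1, -, h3, h4, h5, h6⟩ | ⟨h1, h2, h3, h4⟩)
    · refine ⟨of_eq ?_, by omega⟩
      rw [digitValue_succ, digitValue_succ, h0, digitValue_congr (b := fun k => a (k + 1))]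
      · omega
      · intro k hk
        have := h1 ⟨n - (k + 1), by omega⟩ (by simp; omega)
        simpa only [hidx (k + 1) (by omega)] using this
    · refine ⟨of_eq ?_, by omega⟩
      have ha0 := h1 (Fin.last n) (by simp; omega)
      simp only [Fin.val_last, Nat.sub_self] at ha0
      rw [digitValue_succ, digitValue_succ, h3, ha0,
        digitValue_eq_add_one_of_carry (a := fun k => a (k + 1)) (i := i - 1)
          (by omega) n (by omega)]
      · rw [mul_add, mul_one]; omega
      · intro k hk
        have h1' := h1 ⟨n - (k + 1), by omega⟩ (by simp; omega)
        have h4' := h4 ⟨n - (k + 1), by omega⟩ (by simp; omega) (by simp; omega)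
        simp only [hidx (k + 1) (by omega)] at h1' h4'
        exact ⟨h1', h4'⟩
      · simpa only [hidx i (by omega), Nat.sub_add_cancel hi] using h5
      · intro k hk hk'
        have := h6 ⟨n - (k + 1), by omega⟩ (by simp; omega)
        simpa only [hidx (k + 1) (by omega)] using this
    · refine ⟨?_, by omega⟩
      have hA : digitValue p n (fun k => a (k + 1)) = digitValue p n fun _ => p - 1 :=
        digitValue_congr fun k hk => by
          have := h2 ⟨n - (k + 1), by omega⟩ (by simp; omega)
          simpa only [hidx (k + 1) (by omega)] using this
      have hB : digitValue p n (fun k => b (k + 1)) = 0 := by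
        refine Finset.sum_eq_zero fun k hk => ?_
        have hk := Finset.mem_range.1 hk
        have := h4 ⟨n - (k + 1), by omega⟩ (by simp; omega)
        simp only [hidx (k + 1) (by omega)] at this
        simp only [this, zero_mul]
      have hconst := digitValue_const_add_one (p := p) (by omega) n
      have hS : digitValue p (n + 1) a + 2 = p ^ (n + 1) := by
        rw [digitValue_succ, hA, h1, pow_succ', ← hconst, mul_add, mul_one]; omega
      have hS' : digitValue p (n + 1) b = 1 := by
        rw [digitValue_succ, hB, h3, mul_zero, add_zero]
      have hS_int : (digitValue p (n + 1) a : ℤ) + 2 = (p : ℤ) ^ (n + 1) := by exact_mod_cast hS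
      rw [hS', Int.modEq_iff_dvd, ← hS_int]
      exact ⟨-1, by push_cast; ring⟩
end

section
/- Let p be a prime, f > 1, and i an integer with 0 ≤ i ≤ f−2. Let s' and s'' be digit tuples with s'_{f−1} ≤ p−2 and s''_i ≥ 1, satisfying (−2 − s'_{f−1}) + Σ_{j=0}^{f−2} p^{f−1−j} s'_j ≡ p^{f−1−i}(s''_i − 2) + Σ_{j≠i} p^{f−1−j} s''_j (mod p^f − 1). Then the pair (s', s'') is described by exactly one of the following (entries of s'' not explicitly specified equal the corresponding entries of s'): (A) for some k ∈ [i+1, f−2]: s'_{f−1} ∈ [0,p−2], s'_{f−2} = … = s'_{k+1} = 0, s'_k ∈ [1,p−1], s'_i ∈ [0,p−3]; s''_{f−1} = p−2−s'_{f−1}, s''_j = p−1 for j ∈ [k+1, f−2], s''_k = s'_k − 1, s''_i = s'_i + 2; (B) s'_{f−1} ∈ [0,p−2], s'_{f−2} = … = s'_{i+1} = 0, s'_i ∈ [0,p−2]; s''_{f−1} = p−2−s'_{f−1}, s''_j = p−1 for j ∈ [i+1, f−2], s''_i = s'_i + 1; (C) for some k ∈ [i+1, f−2] and l ∈ [0,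 i−1]: s'_{f−1} ∈ [0,p−2], s'_{f−2} = … = s'_{k+1} = 0, s'_k ∈ [1,p−1], s'_i = … = s'_{l+1} = p−1, s'_l ∈ [0,p−2]; s''_{f−1} = p−2−s'_{f−1}, s''_j = p−1 for j ∈ [k+1, f−2], s''_k = s'_k − 1, s''_i = 1, s''_j = 0 for j ∈ [l+1, i−1], s''_l = s'_l + 1; (D) for some k ∈ [i+1, f−2]: s'_{f−1} ∈ [0,p−2], s'_{f−2} = … = s'_{k+1} = 0, s'_k ∈ [1,p−1], s'_i = s'_{i−1} = … = s'_0 = p−1; s''_{f−1} = p−1−s'_{f−1}, s''_j = p−1 for j ∈ [k+1, f−2], s''_k = s'_k − 1, s''_i = 1, s''_j = 0 for j ∈ [0, i−1]. Conversely, every pair of one of these forms satisfies the congruence and the hypotheses. -/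
namespace Stmt18

/-- weighted sum with the coefficient at index `i` replaced by the integer `v` -/
def wsumMod (p f : ℕ) (s : Fin f → ℕ) (i : ℕ) (v : ℤ) : ℤ :=
  ∑ j : Fin f, (if (j : ℕ) = i then v else (s j : ℤ)) * (p : ℤ) ^ (f - 1 - (j : ℕ))

def ExactlyOne4 (a b c d : Prop) : Prop :=
  (a ∨ b ∨ c ∨ d) ∧ ¬(a ∧ b) ∧ ¬(a ∧ c) ∧ ¬(a ∧ d) ∧ ¬(b ∧ c) ∧ ¬(b ∧ d) ∧ ¬(c ∧ d)

variable (p f : ℕ)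

/-- family (A) -/
def famA (hf : 1 < f) (i : ℕ) (hi : i + 2 ≤ f) (s' s'' : Fin f → ℕ) : Prop :=
  ∃ (k : ℕ) (_ : i + 1 ≤ k) (_ : k + 2 ≤ f),
    s' ⟨f - 1, by omega⟩ ≤ p - 2 ∧
    (∀ j : Fin f, k + 1 ≤ (j : ℕ) → (j : ℕ) + 2 ≤ f → s' j = 0) ∧
    1 ≤ s' ⟨k, by omega⟩ ∧ s' ⟨k, by omega⟩ ≤ p - 1 ∧
    s' ⟨i, by omega⟩ ≤ p - 3 ∧
    s'' ⟨f - 1, by omega⟩ = p - 2 - s' ⟨f - 1, by omega⟩ ∧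
    (∀ j : Fin f, k + 1 ≤ (j : ℕ) → (j : ℕ) + 2 ≤ f → s'' j = p - 1) ∧
    s'' ⟨k, by omega⟩ = s' ⟨k, by omega⟩ - 1 ∧
    s'' ⟨i, by omega⟩ = s' ⟨i, by omega⟩ + 2 ∧
    (∀ j : Fin f, (j : ℕ) < k → (j : ℕ) ≠ i → s'' j = s' j)

/-- family (B) -/
def famB (hf : 1 < f) (i : ℕ) (hi : i + 2 ≤ f) (s' s'' : Fin f → ℕ) : Prop :=
  s' ⟨f - 1, by omega⟩ ≤ p - 2 ∧
  (∀ j : Fin f, i + 1 ≤ (j : ℕ) → (j : ℕ) + 2 ≤ f → s' j = 0) ∧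
  s' ⟨i, by omega⟩ ≤ p - 2 ∧
  s'' ⟨f - 1, by omega⟩ = p - 2 - s' ⟨f - 1, by omega⟩ ∧
  (∀ j : Fin f, i + 1 ≤ (j : ℕ) → (j : ℕ) + 2 ≤ f → s'' j = p - 1) ∧
  s'' ⟨i, by omega⟩ = s' ⟨i, by omega⟩ + 1 ∧
  (∀ j : Fin f, (j : ℕ) < i → s'' j = s' j)

/-- family (C) -/
def famC (hf : 1 < f) (i : ℕ) (hi : i + 2 ≤ f) (s' s'' : Fin f → ℕ) : Prop :=
  ∃ (k : ℕ) (_ : i + 1 ≤ k) (_ : k + 2 ≤ f) (l : ℕ) (_ : l + 1 ≤ i),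
    s' ⟨f - 1, by omega⟩ ≤ p - 2 ∧
    (∀ j : Fin f, k + 1 ≤ (j : ℕ) → (j : ℕ) + 2 ≤ f → s' j = 0) ∧
    1 ≤ s' ⟨k, by omega⟩ ∧ s' ⟨k, by omega⟩ ≤ p - 1 ∧
    (∀ j : Fin f, l + 1 ≤ (j : ℕ) → (j : ℕ) ≤ i → s' j = p - 1) ∧
    s' ⟨l, by omega⟩ ≤ p - 2 ∧
    s'' ⟨f - 1, by omega⟩ = p - 2 - s' ⟨f - 1, by omega⟩ ∧
    (∀ j : Fin f, k + 1 ≤ (j : ℕ) → (j : ℕ) + 2 ≤ f → s'' j = p - 1) ∧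
    s'' ⟨k, by omega⟩ = s' ⟨k, by omega⟩ - 1 ∧
    s'' ⟨i, by omega⟩ = 1 ∧
    (∀ j : Fin f, l + 1 ≤ (j : ℕ) → (j : ℕ) + 1 ≤ i → s'' j = 0) ∧
    s'' ⟨l, by omega⟩ = s' ⟨l, by omega⟩ + 1 ∧
    (∀ j : Fin f, ((i + 1 ≤ (j : ℕ) ∧ (j : ℕ) + 1 ≤ k) ∨ (j : ℕ) < l) → s'' j = s' j)

/-- family (D) -/
def famD (hf : 1 < f) (i : ℕ) (hi : i + 2 ≤ f) (s' s'' : Fin f → ℕ) : Prop :=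
  ∃ (k : ℕ) (_ : i + 1 ≤ k) (_ : k + 2 ≤ f),
    s' ⟨f - 1, by omega⟩ ≤ p - 2 ∧
    (∀ j : Fin f, k + 1 ≤ (j : ℕ) → (j : ℕ) + 2 ≤ f → s' j = 0) ∧
    1 ≤ s' ⟨k, by omega⟩ ∧ s' ⟨k, by omega⟩ ≤ p - 1 ∧
    (∀ j : Fin f, (j : ℕ) ≤ i → s' j = p - 1) ∧
    s'' ⟨f - 1, by omega⟩ = p - 1 - s' ⟨f - 1, by omega⟩ ∧
    (∀ j : Fin f, k + 1 ≤ (j : ℕ) → (j : ℕ) + 2 ≤ f → s'' j = p - 1) ∧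
    s'' ⟨k, by omega⟩ = s' ⟨k, by omega⟩ - 1 ∧
    s'' ⟨i, by omega⟩ = 1 ∧
    (∀ j : Fin f, (j : ℕ) < i → s'' j = 0) ∧
    (∀ j : Fin f, i + 1 ≤ (j : ℕ) → (j : ℕ) + 1 ≤ k → s'' j = s' j)

end Stmt18

namespace Stmt18

/-- A weighted digit sum plus an incoming carry `x` equals `m * p ^ n` exactly when a sequence of
carries runs from `x` at position `n` to `m` at position `0`. -/
theorem exists_carry_iff (p : ℤ) (e : ℕ → ℤ) (m : ℤ) (n : ℕ) (x : ℤ) :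
    (∑ j ∈ Finset.range n, e j * p ^ (n - 1 - j)) + x = m * p ^ n ↔
      ∃ c : ℕ → ℤ, c n = x ∧ c 0 = m ∧ ∀ j < n, e j + c (j + 1) = p * c j := by
  induction n generalizing x with
  | zero =>
    constructor
    · intro h
      exact ⟨fun _ => x, rfl, by simpa using h, by simp⟩
    · rintro ⟨c, rfl, rfl, -⟩
      simp
  | succ n ih =>
    have hS : (∑ j ∈ Finset.range (n + 1), e j * p ^ (n + 1 - 1 - j)) =
        p * (∑ j ∈ Finset.range n, e j * p ^ (n - 1 - j)) + e n := by
      rw [Finset.sum_range_succ, Finset.mul_sum]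
      congr 1
      · refine Finset.sum_congr rfl fun j hj => ?_
        have hj := Finset.mem_range.1 hj
        rw [show n + 1 - 1 - j = (n - 1 - j) + 1 by omega, pow_succ]
        ring
      · simp
    rw [hS]
    constructor
    · intro h
      set S := ∑ j ∈ Finset.range n, e j * p ^ (n - 1 - j)
      have hb : e n + x = p * (m * p ^ n - S) := by
        rw [pow_succ] at h
        linear_combination h
      obtain ⟨c, hcn, hc0, hc⟩ := (ih (m * p ^ n - S)).1 (by ring)
      refine ⟨fun j => if j = n + 1 then x else c j, by simp, by simpa using hc0, ?_⟩
      intro j hj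
      rcases Nat.lt_succ_iff_lt_or_eq.1 hj with hj' | rfl
      · simpa [show j ≠ n by omega, show j ≠ n + 1 by omega] using hc j hj'
      · simpa [hcn] using hb
    · rintro ⟨c, rfl, hc0, hc⟩
      have h := (ih (c n)).2 ⟨c, rfl, hc0, fun j hj => hc j (by omega)⟩
      have hn := hc n (by omega)
      rw [pow_succ]
      linear_combination p * h + hn

/-- The coefficient at position `j` of the difference of the two sides of the congruence. -/
def coeffDiff (f i : ℕ) (a b : ℕ → ℕ) (j : ℕ) : ℤ :=
  (if j = f - 1 then -2 - (a (f - 1) : ℤ) else a j) - (if j = i then (b i : ℤ) - 2 else b j)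

/-- Cyclic carry sequences witnessing the congruence. -/
def IsCarry (p f i : ℕ) (a b : ℕ → ℕ) (c : ℕ → ℤ) : Prop :=
  c f = c 0 ∧ ∀ j < f, coeffDiff f i a b j + c (j + 1) = p * c j

theorem modEq_iff_exists_isCarry {p f i : ℕ} (a b : ℕ → ℕ) :
    Int.ModEq ((p : ℤ) ^ f - 1)
        (wsumMod p f (fun j => a j) (f - 1) (-2 - (a (f - 1) : ℤ)))
        (wsumMod p f (fun j => b j) i ((b i : ℤ) - 2)) ↔
      ∃ c, IsCarry p f i a b c := by
  have hd : wsumMod p f (fun j => a j) (f - 1) (-2 - (a (f - 1) : ℤ)) -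
      wsumMod p f (fun j => b j) i ((b i : ℤ) - 2) =
      ∑ j ∈ Finset.range f, coeffDiff f i a b j * (p : ℤ) ^ (f - 1 - j) := by
    rw [wsumMod, wsumMod, ← Finset.sum_sub_distrib,
      ← Fin.sum_univ_eq_sum_range (fun j => coeffDiff f i a b j * (p : ℤ) ^ (f - 1 - j))]
    refine Finset.sum_congr rfl fun j _ => ?_
    rw [coeffDiff, sub_mul]
  rw [Int.modEq_comm, Int.modEq_iff_dvd, hd]
  constructor
  · rintro ⟨m, hm⟩
    obtain ⟨c, hcf, hc0, hc⟩ := (exists_carry_iff p (coeffDiff f i a b) m f m).1 (by rw [hm]; ring)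
    exact ⟨c, hcf.trans hc0.symm, hc⟩
  · rintro ⟨c, hcf, hc⟩
    refine ⟨c 0, ?_⟩
    have h := (exists_carry_iff p (coeffDiff f i a b) (c 0) f (c f)).2 ⟨c, rfl, rfl, hc⟩
    rw [hcf] at h
    linear_combination h

section Carry

variable {p f i : ℕ} {a b : ℕ → ℕ} {c : ℕ → ℤ}

theorem coeffDiff_last (hi : i + 2 ≤ f) :
    coeffDiff f i a b (f - 1) = -2 - (a (f - 1) : ℤ) - b (f - 1) := by
  simp [coeffDiff, show f - 1 ≠ i by omega]

theorem coeffDiff_special (hi : i + 2 ≤ f) :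
    coeffDiff f i a b i = (a i : ℤ) - b i + 2 := by
  simp [coeffDiff, show i ≠ f - 1 by omega]
  ring

theorem coeffDiff_of_ne {j : ℕ} (hj : j ≠ f - 1) (hji : j ≠ i) :
    coeffDiff f i a b j = (a j : ℤ) - b j := by
  simp [coeffDiff, hj, hji]

theorem IsCarry.last (h : IsCarry p f i a b c) (hi : i + 2 ≤ f) :
    -2 - (a (f - 1) : ℤ) - b (f - 1) + c 0 = p * c (f - 1) := by
  have := h.2 (f - 1) (by omega)
  rwa [coeffDiff_last hi, Nat.sub_add_cancel (by omega), h.1] at this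

theorem IsCarry.special (h : IsCarry p f i a b c) (hi : i + 2 ≤ f) :
    (a i : ℤ) - b i + 2 + c (i + 1) = p * c i := by
  have := h.2 i (by omega)
  rwa [coeffDiff_special hi] at this

theorem IsCarry.step (h : IsCarry p f i a b c) {j : ℕ} (hj : j + 2 ≤ f) (hji : j ≠ i) :
    (a j : ℤ) - b j + c (j + 1) = p * c j := by
  have := h.2 j (by omega)
  rwa [coeffDiff_of_ne (by omega) hji] at this

theorem isCarry_of (hi : i + 2 ≤ f) (h0 : c f = c 0)
    (hlast : -2 - (a (f - 1) : ℤ) - b (f - 1) + c 0 = p * c (f - 1))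
    (hspecial : (a i : ℤ) - b i + 2 + c (i + 1) = p * c i)
    (hstep : ∀ j, j + 2 ≤ f → j ≠ i → (a j : ℤ) - b j + c (j + 1) = p * c j) :
    IsCarry p f i a b c := by
  refine ⟨h0, fun j hj => ?_⟩
  by_cases hji : j = i
  · subst hji
    rwa [coeffDiff_special hi]
  by_cases hjf : j = f - 1
  · subst hjf
    rwa [coeffDiff_last hi, Nat.sub_add_cancel (by omega), h0]
  · rw [coeffDiff_of_ne hjf hji]
    exact hstep j (by omega) hji

/-- Bounds on the outgoing carry `c j` in terms of the incoming carry `c (j + 1)`, valid at every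
position but the last. -/
theorem IsCarry.step_bounds (h : IsCarry p f i a b c) (hp : 2 ≤ p) (ha : ∀ j < f, a j ≤ p - 1)
    (hb : ∀ j < f, b j ≤ p - 1) (hbi : 1 ≤ b i) {j : ℕ} (hj : j + 2 ≤ f) :
    p * c j ≤ p + c (j + 1) ∧ c (j + 1) - (p - 1) ≤ p * c j := by
  have h1 := ha j (by omega)
  have h2 := hb j (by omega)
  by_cases hji : j = i
  · subst hji
    have := h.special hj
    omega
  · have := h.step hj hji
    omega

theorem IsCarry.zero_le_one (h : IsCarry p f i a b c) (hp : 2 ≤ p) (hi : i + 2 ≤ f)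
    (ha : ∀ j < f, a j ≤ p - 1) (hb : ∀ j < f, b j ≤ p - 1) (hbi : 1 ≤ b i) : c 0 ≤ 1 := by
  by_contra! hm
  have hp' : (2 : ℤ) ≤ p := by exact_mod_cast hp
  have key : ∀ j ≤ f - 1, c j ≤ c 0 - 1 := by
    intro j hj
    induction hj using Nat.decreasingInduction with
    | self =>
      have := h.last hi
      nlinarith
    | of_succ j hj ih =>
      have := (h.step_bounds hp ha hb hbi (j := j) (by omega)).1
      nlinarith
  have := key 0 (by omega)
  omega

theorem IsCarry.neg_one_le_zero (h : IsCarry p f i a b c) (hp : 2 ≤ p) (hi : i + 2 ≤ f)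
    (ha : ∀ j < f, a j ≤ p - 1) (hb : ∀ j < f, b j ≤ p - 1) (hbi : 1 ≤ b i)
    (haf : a (f - 1) ≤ p - 2) : -1 ≤ c 0 := by
  by_contra! hm
  have hp' : (2 : ℤ) ≤ p := by exact_mod_cast hp
  have hlast : c 0 ≤ c (f - 1) := by
    have := h.last hi
    have h1 := hb (f - 1) (by omega)
    have h2 : c 0 - 2 * p + 1 ≤ p * c (f - 1) := by omega
    by_contra! h3
    nlinarith
  have hstep : ∀ j, j + 2 ≤ f → c 0 ≤ c (j + 1) → c 0 + 1 ≤ c j := by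
    intro j hj hc
    have := (h.step_bounds hp ha hb hbi hj).2
    by_contra! h3
    nlinarith
  have key : ∀ j ≤ f - 1, c 0 ≤ c j := by
    intro j hj
    induction hj using Nat.decreasingInduction with
    | self => exact hlast
    | of_succ j hj ih =>
      have := hstep j (by omega) ih
      omega
  have := hstep 0 (by omega) (key 1 (by omega))
  omega

theorem IsCarry.zero_nonneg (h : IsCarry p f i a b c) (hp : 2 ≤ p) (hi : i + 2 ≤ f)
    (ha : ∀ j < f, a j ≤ p - 1) (hb : ∀ j < f, b j ≤ p - 1) (hbi : 1 ≤ b i)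
    (haf : a (f - 1) ≤ p - 2) : 0 ≤ c 0 := by
  have hp' : (2 : ℤ) ≤ p := by exact_mod_cast hp
  have hm := h.neg_one_le_zero hp hi ha hb hbi haf
  have above : ∀ j ≤ f - 1, i + 1 ≤ j → -2 ≤ c j := by
    intro j hj
    induction hj using Nat.decreasingInduction with
    | self =>
      intro _
      have := h.last hi
      have h1 := hb (f - 1) (by omega)
      by_contra! h3
      have : (p : ℤ) * c (f - 1) ≤ p * (-3) := by gcongr; omega
      omega
    | of_succ j hj ih =>
      intro hij
      have := (h.step_bounds hp ha hb hbi (j := j) (by omega)).2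
      have := ih (by omega)
      by_contra! h3
      nlinarith
  have below : ∀ j ≤ i, 0 ≤ c j := by
    intro j hj
    induction hj using Nat.decreasingInduction with
    | self =>
      have h1 := h.special hi
      have h2 := above (i + 1) (by omega) le_rfl
      have h3 := hb i (by omega)
      by_contra! h4
      have : (p : ℤ) * c i ≤ p * (-1) := by gcongr; omega
      omega
    | of_succ j hj ih =>
      have := (h.step_bounds hp ha hb hbi (j := j) (by omega)).2
      by_contra! h4
      nlinarith
  exact below 0 (by omega)

/-- A multiple `p * c` lying strictly between `p * (u - 1)` and `p * (u + 1)` has `c = u`. -/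
theorem eq_of_mul_between {p x c : ℤ} (u : ℤ) (hp : 0 < p) (h : x = p * c)
    (h1 : p * (u - 1) < x) (h2 : x < p * (u + 1)) : c = u := by
  rw [h] at h1 h2
  have := lt_of_mul_lt_mul_left h1 hp.le
  have := lt_of_mul_lt_mul_left h2 hp.le
  omega

theorem eq_or_eq_of_mul_between {p x c : ℤ} (u : ℤ) (hp : 0 < p) (h : x = p * c)
    (h1 : p * (u - 1) < x) (h2 : x < p * (u + 2)) : c = u ∨ c = u + 1 := by
  rw [h] at h1 h2
  have := lt_of_mul_lt_mul_left h1 hp.le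
  have := lt_of_mul_lt_mul_left h2 hp.le
  omega

theorem IsCarry.last_eq (h : IsCarry p f i a b c) (hp : 2 ≤ p) (hi : i + 2 ≤ f)
    (ha : ∀ j < f, a j ≤ p - 1) (hb : ∀ j < f, b j ≤ p - 1) (hbi : 1 ≤ b i)
    (haf : a (f - 1) ≤ p - 2) : c (f - 1) = -1 := by
  have h0 := h.zero_nonneg hp hi ha hb hbi haf
  have h1 := h.zero_le_one hp hi ha hb hbi
  have h2 := hb (f - 1) (by omega)
  exact eq_of_mul_between (-1) (by omega) (h.last hi) (by omega) (by omega)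

/-- The digits strictly between position `i` and the last one. -/
theorem IsCarry.above (h : IsCarry p f i a b c) (hp : 2 ≤ p) (hi : i + 2 ≤ f)
    (ha : ∀ j < f, a j ≤ p - 1) (hb : ∀ j < f, b j ≤ p - 1) (hbi : 1 ≤ b i)
    (haf : a (f - 1) ≤ p - 2) (j : ℕ) (hj : j ≤ f - 1) : i + 1 ≤ j →
    (c j = -1 ∧ ∀ t, j ≤ t → t + 2 ≤ f → a t = 0 ∧ b t = p - 1) ∨
    (c j = 0 ∧ ∃ k, j ≤ k ∧ k + 2 ≤ f ∧ (∀ t, k + 1 ≤ t → t + 2 ≤ f → a t = 0 ∧ b t = p - 1) ∧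
      1 ≤ a k ∧ b k = a k - 1 ∧ ∀ t, j ≤ t → t < k → b t = a t) := by
  induction hj using Nat.decreasingInduction with
  | self =>
    intro _
    exact .inl ⟨h.last_eq hp hi ha hb hbi haf, fun t _ _ => by omega⟩
  | of_succ j hj ih =>
    intro hij
    have hs := h.step (j := j) (by omega) (by omega)
    have haj := ha j (by omega)
    have hbj := hb j (by omega)
    rcases ih (by omega) with ⟨hc, hd⟩ | ⟨hc, k, hjk, hkf, hd, hk1, hk2, he⟩
    · rw [hc] at hs
      rcases eq_or_eq_of_mul_between (-1) (by omega) hs (by omega) (by omega) with hcj | hcj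
      · refine .inl ⟨hcj, fun t ht htf => ?_⟩
        rw [hcj] at hs
        rcases eq_or_lt_of_le ht with rfl | ht
        · omega
        · exact hd t ht htf
      · rw [hcj] at hs
        refine .inr ⟨hcj, j, le_rfl, by omega, hd, by omega, by omega, fun t _ _ => by omega⟩
    · rw [hc] at hs
      have hcj := eq_of_mul_between 0 (by omega) hs (by omega) (by omega)
      rw [hcj] at hs
      refine .inr ⟨hcj, k, by omega, hkf, hd, hk1, hk2, fun t ht htk => ?_⟩
      rcases eq_or_lt_of_le ht with rfl | ht
      · omega
      · exact he t ht htk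

/-- Once the carry vanishes at a position `n ≤ i`, all earlier digits agree. -/
theorem IsCarry.below_of_zero (h : IsCarry p f i a b c) (hp : 2 ≤ p) (hi : i + 2 ≤ f)
    (ha : ∀ j < f, a j ≤ p - 1) (hb : ∀ j < f, b j ≤ p - 1) {n : ℕ} (hn : n ≤ i)
    (hc : c n = 0) (j : ℕ) (hj : j ≤ n) : c j = 0 ∧ ∀ t, j ≤ t → t < n → b t = a t := by
  induction hj using Nat.decreasingInduction with
  | self => exact ⟨hc, fun t _ _ => by omega⟩
  | of_succ j hj ih =>
    have hs := h.step (j := j) (by omega) (by omega)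
    have haj := ha j (by omega)
    have hbj := hb j (by omega)
    obtain ⟨hc', he⟩ := ih
    rw [hc'] at hs
    have hcj := eq_of_mul_between 0 (by omega) hs (by omega) (by omega)
    rw [hcj] at hs
    refine ⟨hcj, fun t ht htn => ?_⟩
    rcases eq_or_lt_of_le ht with rfl | ht
    · omega
    · exact he t ht htn

/-- Propagation of a carry `1` out of position `i`. -/
theorem IsCarry.below_of_one (h : IsCarry p f i a b c) (hp : 2 ≤ p) (hi : i + 2 ≤ f)
    (ha : ∀ j < f, a j ≤ p - 1) (hb : ∀ j < f, b j ≤ p - 1)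
    (hc : c i = 1) (j : ℕ) (hj : j ≤ i) :
    (c j = 1 ∧ ∀ t, j ≤ t → t < i → a t = p - 1 ∧ b t = 0) ∨
    (c j = 0 ∧ ∃ l, j ≤ l ∧ l < i ∧ c l = 0 ∧ (∀ t, l < t → t < i → a t = p - 1 ∧ b t = 0) ∧
      a l ≤ p - 2 ∧ b l = a l + 1) := by
  induction hj using Nat.decreasingInduction with
  | self => exact .inl ⟨hc, fun t _ _ => by omega⟩
  | of_succ j hj ih =>
    have hs := h.step (j := j) (by omega) (by omega)
    have haj := ha j (by omega)
    have hbj := hb j (by omega)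
    rcases ih with ⟨hc', hd⟩ | ⟨hc', l, hjl, hli, hl⟩
    · rw [hc'] at hs
      rcases eq_or_eq_of_mul_between 0 (by omega) hs (by omega) (by omega) with hcj | hcj
      · rw [hcj] at hs
        exact .inr ⟨hcj, j, le_rfl, hj, hcj, hd, by omega, by omega⟩
      · rw [hcj] at hs
        refine .inl ⟨hcj, fun t ht hti => ?_⟩
        rcases eq_or_lt_of_le ht with rfl | ht
        · omega
        · exact hd t ht hti
    · rw [hc'] at hs
      have hcj := eq_of_mul_between 0 (by omega) hs (by omega) (by omega)
      exact .inr ⟨hcj, l, by omega, hli, hl⟩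

theorem IsCarry.families (h : IsCarry p f i a b c) (hp : 2 ≤ p) (hf : 1 < f) (hi : i + 2 ≤ f)
    (ha : ∀ j < f, a j ≤ p - 1) (hb : ∀ j < f, b j ≤ p - 1) (hbi : 1 ≤ b i)
    (haf : a (f - 1) ≤ p - 2) :
    famA p f hf i hi (fun j => a j) (fun j => b j) ∨
    famB p f hf i hi (fun j => a j) (fun j => b j) ∨
    famC p f hf i hi (fun j => a j) (fun j => b j) ∨
    famD p f hf i hi (fun j => a j) (fun j => b j) := by
  have hlast := h.last hi
  have hspec := h.special hi
  rw [h.last_eq hp hi ha hb hbi haf] at hlast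
  have hai := ha i (by omega)
  have hbi' := hb i (by omega)
  rcases h.above hp hi ha hb hbi haf (i + 1) (by omega) le_rfl with
    ⟨hc, hd⟩ | ⟨hc, k, hik, hkf, hd, hk1, hk2, he⟩
  · rw [hc] at hspec
    have hci := eq_of_mul_between 0 (by omega) hspec (by omega) (by omega)
    rw [hci] at hspec
    obtain ⟨hc0, hz⟩ := h.below_of_zero hp hi ha hb le_rfl hci 0 (by omega)
    rw [hc0] at hlast
    exact .inr <| .inl ⟨haf, fun j h1 h2 => (hd j h1 h2).1, by dsimp only; omega,
      by dsimp only; omega, fun j h1 h2 => (hd j h1 h2).2, by dsimp only; omega,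
      fun j hj => hz j (by omega) hj⟩
  · have hak := ha k (by omega)
    rw [hc] at hspec
    rcases eq_or_eq_of_mul_between 0 (by omega) hspec (by omega) (by omega) with hci | hci
    · rw [hci] at hspec
      obtain ⟨hc0, hz⟩ := h.below_of_zero hp hi ha hb le_rfl hci 0 (by omega)
      rw [hc0] at hlast
      refine .inl ⟨k, hik, hkf, haf, fun j h1 h2 => (hd j h1 h2).1, hk1, hak,
        by dsimp only; omega, by dsimp only; omega, fun j h1 h2 => (hd j h1 h2).2, hk2,
        by dsimp only; omega, fun j hj hji => ?_⟩
      rcases lt_or_gt_of_ne hji with hlt | hgt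
      · exact hz j (by omega) hlt
      · exact he j hgt hj
    · rw [hci] at hspec
      rcases h.below_of_one hp hi ha hb hci 0 (by omega) with
        ⟨hc0, hz⟩ | ⟨hc0, l, -, hli, hcl, hz, hl1, hl2⟩
      · rw [hc0] at hlast
        refine .inr <| .inr <| .inr ⟨k, hik, hkf, haf, fun j h1 h2 => (hd j h1 h2).1, hk1, hak,
          fun j hj => ?_, by dsimp only; omega, fun j h1 h2 => (hd j h1 h2).2, hk2,
          by dsimp only; omega, fun j hj => (hz j (by omega) hj).2, fun j h1 h2 => he j h1 h2⟩
        rcases eq_or_lt_of_le hj with hj | hj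
        · dsimp only
          rw [hj]
          omega
        · exact (hz j (by omega) hj).1
      · rw [hc0] at hlast
        have hlow := (h.below_of_zero hp hi ha hb hli.le hcl 0 (by omega)).2
        refine .inr <| .inr <| .inl ⟨k, hik, hkf, l, hli, haf, fun j h1 h2 => (hd j h1 h2).1,
          hk1, hak, fun j h1 hj => ?_, hl1, by dsimp only; omega,
          fun j h1 h2 => (hd j h1 h2).2, hk2, by dsimp only; omega,
          fun j h1 h2 => (hz j h1 h2).2, hl2, fun j hj => ?_⟩
        · rcases eq_or_lt_of_le hj with hj | hj
          · dsimp only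
            rw [hj]
            omega
          · exact (hz j h1 hj).1
        · rcases hj with ⟨h1, h2⟩ | hj
          · exact he j h1 h2
          · exact hlow j (by omega) hj

end Carry

section Converse

variable {p f i : ℕ} {a b : ℕ → ℕ}

theorem isCarry_of_famA (hp : 2 ≤ p) (hf : 1 < f) (hi : i + 2 ≤ f)
    (h : famA p f hf i hi (fun j => a j) (fun j => b j)) :
    (∃ c, IsCarry p f i a b c) ∧ a (f - 1) ≤ p - 2 ∧ 1 ≤ b i := by
  simp only [famA, Fin.forall_iff] at h
  obtain ⟨k, hik, hkf, haf, hz, hk1, hk2, hai, hbf, hbz, hbk, hbi, he⟩ := h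
  refine ⟨⟨fun j => if k < j ∧ j < f then -1 else 0, isCarry_of hi ?_ ?_ ?_ ?_⟩, haf, by omega⟩
  · simp
  · simp [show k < f - 1 by omega, show 0 < f by omega]
    omega
  · simp [show ¬ k < i by omega, show ¬ k < i + 1 by omega]
    omega
  · intro j hj hji
    have h1 := hz j (by omega)
    have h2 := hbz j (by omega)
    have h3 := he j (by omega)
    rcases lt_trichotomy j k with hjk | rfl | hjk
    · simp [show ¬ k < j by omega, show ¬ k < j + 1 by omega]
      omega
    · simp [show j + 1 < f by omega]
      omega
    · simp [show k < j + 1 by omega, hjk, show j + 1 < f by omega, show j < f by omega]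
      omega

theorem isCarry_of_famB (hp : 2 ≤ p) (hf : 1 < f) (hi : i + 2 ≤ f)
    (h : famB p f hf i hi (fun j => a j) (fun j => b j)) :
    (∃ c, IsCarry p f i a b c) ∧ a (f - 1) ≤ p - 2 ∧ 1 ≤ b i := by
  simp only [famB, Fin.forall_iff] at h
  obtain ⟨haf, hz, hai, hbf, hbz, hbi, he⟩ := h
  refine ⟨⟨fun j => if i < j ∧ j < f then -1 else 0, isCarry_of hi ?_ ?_ ?_ ?_⟩, haf, by omega⟩
  · simp
  · simp [show i < f - 1 by omega, show 0 < f by omega]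
    omega
  · simp [show i + 1 < f by omega]
    omega
  · intro j hj hji
    have h1 := hz j (by omega)
    have h2 := hbz j (by omega)
    have h3 := he j (by omega)
    rcases lt_or_gt_of_ne hji with hjk | hjk
    · simp [show ¬ i < j by omega, show ¬ i < j + 1 by omega]
      omega
    · simp [show i < j + 1 by omega, hjk, show j + 1 < f by omega, show j < f by omega]
      omega

theorem isCarry_of_famC (hp : 2 ≤ p) (hf : 1 < f) (hi : i + 2 ≤ f)
    (h : famC p f hf i hi (fun j => a j) (fun j => b j)) :
    (∃ c, IsCarry p f i a b c) ∧ a (f - 1) ≤ p - 2 ∧ 1 ≤ b i := by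
  simp only [famC, Fin.forall_iff] at h
  obtain ⟨k, hik, hkf, l, hli, haf, hz, hk1, hk2, hap, hal, hbf, hbz, hbk, hbi, hb0, hbl, he⟩ := h
  have hai := hap i (by omega) hli le_rfl
  let c : ℕ → ℤ := fun j => if k < j ∧ j < f then -1 else if l < j ∧ j ≤ i then 1 else 0
  have c_neg : ∀ j, k < j → j < f → c j = -1 := fun j h1 h2 => if_pos ⟨h1, h2⟩
  have c_one : ∀ j, l < j → j ≤ i → c j = 1 := fun j h1 h2 => by
    simp [c, h1, h2, show ¬ k < j by omega]
  have c_zero : ∀ j, i < j → j ≤ k → c j = 0 := fun j h1 h2 => by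
    simp [c, show ¬ k < j by omega, show ¬ j ≤ i by omega]
  have c_low : ∀ j, j ≤ l → c j = 0 := fun j h1 => by
    simp [c, show ¬ k < j by omega, show ¬ l < j by omega]
  have c_f : c f = 0 := by simp [c, show ¬ f ≤ i by omega]
  refine ⟨⟨c, isCarry_of hi ?_ ?_ ?_ ?_⟩, haf, by omega⟩
  · rw [c_f, c_low 0 (by omega)]
  · rw [c_low 0 (by omega), c_neg (f - 1) (by omega) (by omega)]
    omega
  · rw [c_zero (i + 1) (by omega) (by omega), c_one i (by omega) le_rfl]
    omega
  · intro j hj hji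
    have h1 := hz j (by omega)
    have h2 := hbz j (by omega)
    have h3 := he j (by omega)
    have h4 := hap j (by omega)
    have h5 := hb0 j (by omega)
    rcases lt_or_gt_of_ne hji with hlt | hgt
    · rcases lt_trichotomy j l with hjl | rfl | hjl
      · rw [c_low (j + 1) (by omega), c_low j (by omega)]
        omega
      · rw [c_one (j + 1) (by omega) (by omega), c_low j (by omega)]
        omega
      · rw [c_one (j + 1) (by omega) (by omega), c_one j (by omega) (by omega)]
        omega
    · rcases lt_trichotomy j k with hjk | rfl | hjk
      · rw [c_zero (j + 1) (by omega) (by omega), c_zero j (by omega) (by omega)]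
        omega
      · rw [c_neg (j + 1) (by omega) (by omega), c_zero j (by omega) (by omega)]
        omega
      · rw [c_neg (j + 1) (by omega) (by omega), c_neg j (by omega) (by omega)]
        omega

theorem isCarry_of_famD (hp : 2 ≤ p) (hf : 1 < f) (hi : i + 2 ≤ f)
    (h : famD p f hf i hi (fun j => a j) (fun j => b j)) :
    (∃ c, IsCarry p f i a b c) ∧ a (f - 1) ≤ p - 2 ∧ 1 ≤ b i := by
  simp only [famD, Fin.forall_iff] at h
  obtain ⟨k, hik, hkf, haf, hz, hk1, hk2, hap, hbf, hbz, hbk, hbi, hb0, he⟩ := h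
  have hai := hap i (by omega) le_rfl
  let c : ℕ → ℤ := fun j => if k < j ∧ j < f then -1 else if j ≤ i ∨ j = f then 1 else 0
  have c_neg : ∀ j, k < j → j < f → c j = -1 := fun j h1 h2 => if_pos ⟨h1, h2⟩
  have c_one : ∀ j, j ≤ i → c j = 1 := fun j h1 => by
    simp [c, h1, show ¬ k < j by omega]
  have c_zero : ∀ j, i < j → j ≤ k → c j = 0 := fun j h1 h2 => by
    simp [c, show ¬ k < j by omega, show ¬ j ≤ i by omega, show j ≠ f by omega]
  have c_f : c f = 1 := by simp [c]
  refine ⟨⟨c, isCarry_of hi ?_ ?_ ?_ ?_⟩, haf, by omega⟩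
  · rw [c_f, c_one 0 (by omega)]
  · rw [c_one 0 (by omega), c_neg (f - 1) (by omega) (by omega)]
    omega
  · rw [c_zero (i + 1) (by omega) (by omega), c_one i le_rfl]
    omega
  · intro j hj hji
    have h1 := hz j (by omega)
    have h2 := hbz j (by omega)
    have h3 := he j (by omega)
    have h4 := hap j (by omega)
    have h5 := hb0 j (by omega)
    rcases lt_or_gt_of_ne hji with hlt | hgt
    · rw [c_one (j + 1) (by omega), c_one j (by omega)]
      omega
    · rcases lt_trichotomy j k with hjk | rfl | hjk
      · rw [c_zero (j + 1) (by omega) (by omega), c_zero j (by omega) (by omega)]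
        omega
      · rw [c_neg (j + 1) (by omega) (by omega), c_zero j (by omega) (by omega)]
        omega
      · rw [c_neg (j + 1) (by omega) (by omega), c_neg j (by omega) (by omega)]
        omega

/-- The four families are pairwise disjoint. -/
theorem families_disjoint (hp : 2 ≤ p) (hf : 1 < f) (hi : i + 2 ≤ f) {s t : Fin f → ℕ}
    (ht : ∀ j, t j ≤ p - 1) :
    ¬(famA p f hf i hi s t ∧ famB p f hf i hi s t) ∧
    ¬(famA p f hf i hi s t ∧ famC p f hf i hi s t) ∧
    ¬(famA p f hf i hi s t ∧ famD p f hf i hi s t) ∧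
    ¬(famB p f hf i hi s t ∧ famC p f hf i hi s t) ∧
    ¬(famB p f hf i hi s t ∧ famD p f hf i hi s t) ∧
    ¬(famC p f hf i hi s t ∧ famD p f hf i hi s t) := by
  have hti := ht ⟨i, by omega⟩
  refine ⟨?_, ?_, ?_, ?_, ?_, ?_⟩
  · rintro ⟨⟨k, h1, h2, _, _, h3, _⟩, ⟨_, h4, _⟩⟩
    have := h4 ⟨k, by omega⟩ h1 h2
    omega
  · rintro ⟨⟨k, _, _, _, _, _, _, h1, _, _, _, h2, _⟩, ⟨_, _, _, l, h3, _, _, _, _, h4, _⟩⟩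
    have := h4 ⟨i, by omega⟩ h3 le_rfl
    omega
  · rintro ⟨⟨k, _, _, _, _, _, _, h1, _, _, _, h2, _⟩, ⟨_, _, _, _, _, _, _, h4, _⟩⟩
    have := h4 ⟨i, by omega⟩ le_rfl
    omega
  · rintro ⟨⟨_, h4, _⟩, ⟨k, h1, h2, l, _, _, _, h3, _⟩⟩
    have := h4 ⟨k, by omega⟩ h1 h2
    omega
  · rintro ⟨⟨_, h4, _⟩, ⟨k, h1, h2, _, _, h3, _⟩⟩
    have := h4 ⟨k, by omega⟩ h1 h2
    omega
  · rintro ⟨⟨_, _, _, l, h1, _, _, _, _, _, h2, _⟩, ⟨_, _, _, _, _, _, _, h4, _⟩⟩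
    have := h4 ⟨l, by omega⟩ (by dsimp only; omega)
    omega

end Converse

theorem exists_eq_comp_val {f : ℕ} (s : Fin f → ℕ) : ∃ a : ℕ → ℕ, s = fun j : Fin f => a j :=
  ⟨fun j => if h : j < f then s ⟨j, h⟩ else 0, by ext j; simp⟩

end Stmt18

open Stmt18 in
/-- Classification of pairs of digit tuples `(s', s'')` with `s'_{f-1} ≤ p-2`, `s''_i ≥ 1` and
`(-2-s'_{f-1}) + Σ_{j≤f-2} p^{f-1-j} s'_j ≡ p^{f-1-i}(s''_i-2) + Σ_{j≠i} p^{f-1-j} s''_j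
(mod p^f - 1)`. -/
theorem statement18 (p f : ℕ) (hp : p.Prime) (hf : 1 < f)
    (i : ℕ) (hi : i + 2 ≤ f)
    (s' s'' : Fin f → ℕ)
    (hs' : ∀ j, s' j ≤ p - 1) (hs'' : ∀ j, s'' j ≤ p - 1) :
    (s' ⟨f - 1, by omega⟩ ≤ p - 2 → 1 ≤ s'' ⟨i, by omega⟩ →
      Int.ModEq ((p : ℤ) ^ f - 1)
        (wsumMod p f s' (f - 1) (-2 - (s' ⟨f - 1, by omega⟩ : ℤ)))
        (wsumMod p f s'' i ((s'' ⟨i, by omega⟩ : ℤ) - 2)) →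
      ExactlyOne4 (famA p f hf i hi s' s'') (famB p f hf i hi s' s'')
        (famC p f hf i hi s' s'') (famD p f hf i hi s' s'')) ∧
    ((famA p f hf i hi s' s'' ∨ famB p f hf i hi s' s'' ∨ famC p f hf i hi s' s'' ∨
        famD p f hf i hi s' s'') →
      (Int.ModEq ((p : ℤ) ^ f - 1)
          (wsumMod p f s' (f - 1) (-2 - (s' ⟨f - 1, by omega⟩ : ℤ)))
          (wsumMod p f s'' i ((s'' ⟨i, by omega⟩ : ℤ) - 2)) ∧
        s' ⟨f - 1, by omega⟩ ≤ p - 2 ∧ 1 ≤ s'' ⟨i, by omega⟩)) := by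
  have hp2 := hp.two_le
  obtain ⟨a, rfl⟩ := exists_eq_comp_val s'
  obtain ⟨b, rfl⟩ := exists_eq_comp_val s''
  simp only [Fin.forall_iff] at hs' hs''
  dsimp only
  rw [modEq_iff_exists_isCarry]
  constructor
  · rintro haf hbi ⟨c, hc⟩
    exact ⟨hc.families hp2 hf hi hs' hs'' hbi haf,
      families_disjoint hp2 hf hi (Fin.forall_iff.2 hs'')⟩
  · rintro (h | h | h | h)
    · exact isCarry_of_famA hp2 hf hi h
    · exact isCarry_of_famB hp2 hf hi h
    · exact isCarry_of_famC hp2 hf hi h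
    · exact isCarry_of_famD hp2 hf hi h
end
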